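/- Under bounded beliefs (π(s|θ) > 0 for all s, θ and ρ(θ'|θ) > 0 for all θ, θ'), the sets η^n_{ρ,Π}(Δ(Θ)) for n ≥ 1 form a decreasing nested sequence (η^{n+1}_{ρ,Π}(Δ(Θ)) ⊆ η^n_{ρ,Π}(Δ(Θ))) of nonempty compact convex subsets of Δ(Θ); consequently, η^∞_{ρ,Π} = ⋂_{n≥1} η^n_{ρ,Π}(Δ(Θ)) is a nonempty compact convex set. -/

import Mathlib

/-- One-step belief update r_{ρ,Π}(s|μ): here ρ θ θ' denotes the transition
probability ρ(θ'|θ) from θ to θ'. -/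
noncomputable def update {Θ S : Type*} [Fintype Θ] (π : S → Θ → ℝ) (ρ : Θ → Θ → ℝ)
    (s : S) (μ : Θ → ℝ) : Θ → ℝ :=
  fun θ' => π s θ' * (∑ θ, ρ θ θ' * μ θ) / ∑ θ'', π s θ'' * ∑ θ, ρ θ θ'' * μ θ

/-- The map η_{ρ,Π} on subsets of beliefs:
η(X) = conv({ r_{ρ,Π}(s|μ) : s ∈ S, μ ∈ X }). -/
noncomputable def etaMap {Θ S : Type*} [Fintype Θ] (π : S → Θ → ℝ) (ρ : Θ → Θ → ℝ)
    (X : Set (Θ → ℝ)) : Set (Θ → ℝ) :=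
  convexHull ℝ {ν : Θ → ℝ | ∃ s : S, ∃ μ ∈ X, ν = update π ρ s μ}

/-- η^∞_{ρ,Π} = ⋂_{n ≥ 1} η^n_{ρ,Π}(Δ(Θ)). -/
noncomputable def etaInf {Θ S : Type*} [Fintype Θ] (π : S → Θ → ℝ) (ρ : Θ → Θ → ℝ) :
    Set (Θ → ℝ) :=
  ⋂ n : ℕ, (etaMap π ρ)^[n + 1] (stdSimplex ℝ Θ)

/-- In a finite-dimensional space, the convex hull of a compact set is compact. -/
theorem IsCompact.convexHull_of_finiteDimensional {E : Type*} [AddCommGroup E] [Module ℝ E]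
    [FiniteDimensional ℝ E] [TopologicalSpace E] [ContinuousAdd E] [ContinuousSMul ℝ E]
    {s : Set E} (hs : IsCompact s) : IsCompact (convexHull ℝ s) := by
  let C : ℕ → Set E := fun k =>
    (fun p : (Fin k → ℝ) × (Fin k → E) => ∑ i, p.1 i • p.2 i) ''
      (stdSimplex ℝ (Fin k) ×ˢ Set.univ.pi fun _ => s)
  have hC : ∀ k, IsCompact (C k) := fun k =>
    ((isCompact_stdSimplex ℝ (Fin k)).prod (isCompact_univ_pi fun _ => hs)).image (by fun_prop)
  have h : convexHull ℝ s = ⋃ k ∈ Set.Iic (Module.finrank ℝ E + 1), C k := by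
    apply Set.Subset.antisymm
    · intro x hx
      obtain ⟨ι, _, z, w, hz, hind, hw, hw1, rfl⟩ := eq_pos_convex_span_of_mem_convexHull hx
      let e := Fintype.equivFin ι
      have hcard : Fintype.card ι ≤ Module.finrank ℝ E + 1 :=
        hind.card_le_finrank_succ.trans (Nat.succ_le_succ (Submodule.finrank_le _))
      refine Set.mem_biUnion hcard ⟨(w ∘ e.symm, z ∘ e.symm),
        ⟨⟨fun i => (hw _).le, ?_⟩, fun i _ => hz ⟨_, rfl⟩⟩, ?_⟩
      · exact (Equiv.sum_comp e.symm w).trans hw1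
      · exact Equiv.sum_comp e.symm fun i => w i • z i
    · refine Set.iUnion₂_subset fun k _ => ?_
      rintro _ ⟨p, ⟨hp, hps⟩, rfl⟩
      exact (convex_convexHull ℝ s).sum_mem (fun i _ => hp.1 i) hp.2
        fun i _ => subset_convexHull ℝ s (hps i trivial)
  rw [h]
  exact (Set.finite_Iic _).isCompact_biUnion fun k _ => hC k

section BeliefUpdate

variable {Θ S : Type*} [Fintype Θ] {π : S → Θ → ℝ} {ρ : Θ → Θ → ℝ}

theorem etaMap_mono : Monotone (etaMap π ρ) := fun _ _ h =>
  convexHull_mono fun _ ⟨s, μ, hμ, hν⟩ => ⟨s, μ, h hμ, hν⟩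

theorem convex_etaMap (X : Set (Θ → ℝ)) : Convex ℝ (etaMap π ρ X) :=
  convex_convexHull ℝ _

theorem etaMap_nonempty [Nonempty S] {X : Set (Θ → ℝ)} (hX : X.Nonempty) :
    (etaMap π ρ X).Nonempty := by
  obtain ⟨μ, hμ⟩ := hX
  exact ⟨_, subset_convexHull ℝ _ ⟨Classical.arbitrary S, μ, hμ, rfl⟩⟩

theorem transition_pos (hρ0 : ∀ θ θ', 0 < ρ θ θ') {μ : Θ → ℝ} (hμ : μ ∈ stdSimplex ℝ Θ) (θ' : Θ) :
    0 < ∑ θ, ρ θ θ' * μ θ := by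
  obtain ⟨θ, -, hθ⟩ : ∃ θ ∈ Finset.univ, 0 < μ θ :=
    Finset.exists_lt_of_sum_lt (f := fun _ => (0 : ℝ)) (by simp [hμ.2])
  exact Finset.sum_pos' (fun θ _ => mul_nonneg (hρ0 θ θ').le (hμ.1 θ))
    ⟨θ, Finset.mem_univ θ, mul_pos (hρ0 θ θ') hθ⟩

variable [Nonempty Θ]

theorem signal_prob_pos (hπ0 : ∀ s θ, 0 < π s θ) (hρ0 : ∀ θ θ', 0 < ρ θ θ') (s : S)
    {μ : Θ → ℝ} (hμ : μ ∈ stdSimplex ℝ Θ) :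
    0 < ∑ θ', π s θ' * ∑ θ, ρ θ θ' * μ θ :=
  Finset.sum_pos (fun θ' _ => mul_pos (hπ0 s θ') (transition_pos hρ0 hμ θ'))
    Finset.univ_nonempty

theorem update_mem_stdSimplex (hπ0 : ∀ s θ, 0 < π s θ) (hρ0 : ∀ θ θ', 0 < ρ θ θ') (s : S)
    {μ : Θ → ℝ} (hμ : μ ∈ stdSimplex ℝ Θ) : update π ρ s μ ∈ stdSimplex ℝ Θ := by
  have hpos := signal_prob_pos hπ0 hρ0 s hμ
  refine ⟨fun θ' => div_nonneg (mul_pos (hπ0 s θ') (transition_pos hρ0 hμ θ')).le hpos.le, ?_⟩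
  simp only [update]
  rw [← Finset.sum_div, div_self hpos.ne']

theorem continuousOn_update (hπ0 : ∀ s θ, 0 < π s θ) (hρ0 : ∀ θ θ', 0 < ρ θ θ') (s : S) :
    ContinuousOn (update π ρ s) (stdSimplex ℝ Θ) := by
  refine continuousOn_pi.2 fun θ' => ContinuousOn.div ?_ ?_ fun μ hμ =>
    (signal_prob_pos hπ0 hρ0 s hμ).ne'
  · fun_prop
  · fun_prop

theorem etaMap_subset_stdSimplex (hπ0 : ∀ s θ, 0 < π s θ) (hρ0 : ∀ θ θ', 0 < ρ θ θ')
    {X : Set (Θ → ℝ)} (hX : X ⊆ stdSimplex ℝ Θ) : etaMap π ρ X ⊆ stdSimplex ℝ Θ := by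
  refine convexHull_min ?_ (convex_stdSimplex ℝ Θ)
  rintro _ ⟨s, μ, hμ, rfl⟩
  exact update_mem_stdSimplex hπ0 hρ0 s (hX hμ)

theorem isCompact_etaMap [Finite S] (hπ0 : ∀ s θ, 0 < π s θ) (hρ0 : ∀ θ θ', 0 < ρ θ θ')
    {X : Set (Θ → ℝ)} (hX : X ⊆ stdSimplex ℝ Θ) (hXc : IsCompact X) :
    IsCompact (etaMap π ρ X) := by
  have h : {ν : Θ → ℝ | ∃ s : S, ∃ μ ∈ X, ν = update π ρ s μ} = ⋃ s, update π ρ s '' X := by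
    ext ν
    simp [eq_comm]
  unfold etaMap
  rw [h]
  exact (isCompact_iUnion fun s => hXc.image_of_continuousOn
    ((continuousOn_update hπ0 hρ0 s).mono hX)).convexHull_of_finiteDimensional

theorem etaMap_iterate_succ_subset (hπ0 : ∀ s θ, 0 < π s θ) (hρ0 : ∀ θ θ', 0 < ρ θ θ') (n : ℕ) :
    (etaMap π ρ)^[n + 1] (stdSimplex ℝ Θ) ⊆ (etaMap π ρ)^[n] (stdSimplex ℝ Θ) := by
  rw [Function.iterate_succ_apply]
  exact etaMap_mono.iterate n (etaMap_subset_stdSimplex hπ0 hρ0 subset_rfl)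

theorem etaMap_iterate_properties [Finite S] [Nonempty S]
    (hπ0 : ∀ s θ, 0 < π s θ) (hρ0 : ∀ θ θ', 0 < ρ θ θ') (n : ℕ) :
    ((etaMap π ρ)^[n] (stdSimplex ℝ Θ)).Nonempty ∧
      IsCompact ((etaMap π ρ)^[n] (stdSimplex ℝ Θ)) ∧
      Convex ℝ ((etaMap π ρ)^[n] (stdSimplex ℝ Θ)) ∧
      (etaMap π ρ)^[n] (stdSimplex ℝ Θ) ⊆ stdSimplex ℝ Θ := by
  induction n with
  | zero =>
    classical
    exact ⟨⟨_, single_mem_stdSimplex ℝ (Classical.arbitrary Θ)⟩, isCompact_stdSimplex ℝ Θ,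
      convex_stdSimplex ℝ Θ, subset_rfl⟩
  | succ n ih =>
    obtain ⟨hne, hc, -, hsub⟩ := ih
    rw [Function.iterate_succ_apply']
    exact ⟨etaMap_nonempty hne, isCompact_etaMap hπ0 hρ0 hsub hc, convex_etaMap _,
      etaMap_subset_stdSimplex hπ0 hρ0 hsub⟩

end BeliefUpdate

/-- under bounded beliefs, the sets η^n_{ρ,Π}(Δ(Θ)), n ≥ 1, form a
decreasing nested sequence of nonempty compact convex subsets of Δ(Θ); consequently
η^∞_{ρ,Π} is a nonempty compact convex set. -/
theorem etaIterates_nested_compact_convex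
    {Θ S : Type*} [Fintype Θ] [Nonempty Θ] [Fintype S] [Nonempty S]
    (π : S → Θ → ℝ) (hπ0 : ∀ s θ, 0 < π s θ) (hπ1 : ∀ θ, ∑ s, π s θ = 1)
    (ρ : Θ → Θ → ℝ) (hρ0 : ∀ θ θ', 0 < ρ θ θ') (hρ1 : ∀ θ, ∑ θ', ρ θ θ' = 1) :
    -- the sequence is decreasing: η^{n+1}(Δ) ⊆ η^n(Δ) for n ≥ 1
    (∀ n : ℕ, (etaMap π ρ)^[n + 2] (stdSimplex ℝ Θ) ⊆ (etaMap π ρ)^[n + 1] (stdSimplex ℝ Θ)) ∧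
    -- each η^n(Δ), n ≥ 1, is a nonempty compact convex subset of Δ(Θ)
    (∀ n : ℕ,
      ((etaMap π ρ)^[n + 1] (stdSimplex ℝ Θ)).Nonempty ∧
      IsCompact ((etaMap π ρ)^[n + 1] (stdSimplex ℝ Θ)) ∧
      Convex ℝ ((etaMap π ρ)^[n + 1] (stdSimplex ℝ Θ)) ∧
      (etaMap π ρ)^[n + 1] (stdSimplex ℝ Θ) ⊆ stdSimplex ℝ Θ) ∧
    -- consequently η^∞ is nonempty, compact and convex
    ((etaInf π ρ).Nonempty ∧ IsCompact (etaInf π ρ) ∧ Convex ℝ (etaInf π ρ)) := by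
  have hdec := fun n => etaMap_iterate_succ_subset hπ0 hρ0 (n + 1)
  have hprop := fun n => etaMap_iterate_properties hπ0 hρ0 (n + 1)
  refine ⟨hdec, hprop, ?_, ?_, convex_iInter fun n => (hprop n).2.2.1⟩
  · exact IsCompact.nonempty_iInter_of_sequence_nonempty_isCompact_isClosed _ hdec
      (fun n => (hprop n).1) (hprop 0).2.1 fun n => (hprop n).2.1.isClosed
  · exact (hprop 0).2.1.of_isClosed_subset (isClosed_iInter fun n => (hprop n).2.1.isClosed)
      (Set.iInter_subset _ 0)
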